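/- Let T be a tree of diameter 5 with vertex set {v_1, ..., v_n}, where v_1 and v_2 are its two central vertices (the two adjacent vertices of eccentricity 3). For k = 1, 2, let NL_k be the set of neighbours of v_k other than v_{3-k} that are not leaves of T, and let m_k = min{ s_v : v ∈ NL_k }. Let s_1, ..., s_n be integers with s_i ≥ 2 for all i, s_1 = s_2 = 2, and suppose 2 ≤ m_1 ≤ 3 or 2 ≤ m_2 ≤ 3. If |NL_1| ≥ 2 and |NL_2| ≥ 2, then no orientation of T(s_1, ..., s_n) has diameter 5; consequently d̄(T(s_1, ..., s_n)) = 6 and T(s_1, ..., s_n) ∈ C_1. -/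

import Mathlib

open SimpleGraph

variable {V : Type*}

/-- `D` is an orientation of `G`: every arc of `D` is an edge of `G`, and every edge of `G`
receives exactly one of the two possible directions. -/
def IsOrientation (G : SimpleGraph V) (D : V → V → Prop) : Prop :=
  (∀ u v, D u v → G.Adj u v) ∧ ∀ u v, G.Adj u v → (D u v ↔ ¬ D v u)

/-- There is a directed walk of length `n` from `u` to `v` in the digraph `D`. -/
def DPath (D : V → V → Prop) : ℕ → V → V → Prop
  | 0, u, v => u = v
  | n + 1, u, v => ∃ w, D u w ∧ DPath D n w v

/-- Directed distance from `u` to `v` (`⊤` if `v` is not reachable from `u`). -/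
noncomputable def ddist (D : V → V → Prop) (u v : V) : ℕ∞ :=
  sInf {n : ℕ∞ | ∃ m : ℕ, n = (m : ℕ∞) ∧ DPath D m u v}

/-- Diameter of a digraph: supremum of directed distances over all ordered pairs. -/
noncomputable def odiam (D : V → V → Prop) : ℕ∞ :=
  ⨆ u : V, ⨆ v : V, ddist D u v

/-- A strong orientation of `G`: an orientation in which every vertex is reachable
from every other vertex by a directed path. -/
def IsStrongOrientation (G : SimpleGraph V) (D : V → V → Prop) : Prop :=
  IsOrientation G D ∧ ∀ u v, ∃ m : ℕ, DPath D m u v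

/-- The orientation number of `G`: minimum diameter over all strong orientations. -/
noncomputable def orientNum (G : SimpleGraph V) : ℕ∞ :=
  sInf {d : ℕ∞ | ∃ D : V → V → Prop, IsStrongOrientation G D ∧ d = odiam D}

/-- The vertex-multiplication `G(s)`: vertex `v` is replaced by `s v` copies, and copies of
`v_i`, `v_j` are adjacent iff `v_i v_j` is an edge of `G` (whence `i ≠ j`). -/
def vertexMult (G : SimpleGraph V) (s : V → ℕ) : SimpleGraph (Σ v : V, Fin (s v)) where
  Adj x y := G.Adj x.1 y.1
  symm := ⟨fun _ _ h => G.symm.symm _ _ h⟩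
  loopless := ⟨fun x h => G.loopless.irrefl x.1 h⟩

/-- Eccentricity of a vertex. -/
noncomputable def ecc (G : SimpleGraph V) (v : V) : ℕ∞ :=
  ⨆ u : V, G.edist v u

theorem DPath.append {D : V → V → Prop} {m n : ℕ} {u v w : V} (h₁ : DPath D m u v)
    (h₂ : DPath D n v w) : DPath D (m + n) u w := by
  induction m generalizing u with
  | zero => cases h₁; simpa using h₂
  | succ k ih =>
    obtain ⟨x, hx, hp⟩ := h₁
    rw [Nat.succ_add]
    exact ⟨x, hx, ih hp⟩

theorem DPath.single {D : V → V → Prop} {u v : V} (h : D u v) : DPath D 1 u v := ⟨v, h, rfl⟩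

theorem DPath.two {D : V → V → Prop} {u v w : V} (h₁ : D u v) (h₂ : D v w) : DPath D 2 u w :=
  ⟨v, h₁, w, h₂, rfl⟩

theorem exists_dPath_of_odiam_le {D : V → V → Prop} {n : ℕ} (h : odiam D ≤ n) (u v : V) :
    ∃ m ≤ n, DPath D m u v := by
  have h1 : ddist D u v ≤ n := le_trans (le_iSup₂ (f := fun u v => ddist D u v) u v) h
  have hne : {n : ℕ∞ | ∃ m : ℕ, n = (m : ℕ∞) ∧ DPath D m u v}.Nonempty := by
    by_contra hc
    rw [Set.not_nonempty_iff_eq_empty] at hc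
    rw [ddist, hc, sInf_empty] at h1
    simp at h1
  obtain ⟨m, hm, hp⟩ := csInf_mem hne
  refine ⟨m, ?_, hp⟩
  rw [ddist, hm] at h1
  exact_mod_cast h1

theorem odiam_le_of_exists_dPath {D : V → V → Prop} {n : ℕ}
    (h : ∀ u v, ∃ m ≤ n, DPath D m u v) : odiam D ≤ n := by
  refine iSup₂_le fun u v => ?_
  obtain ⟨m, hm, hp⟩ := h u v
  exact le_trans (sInf_le ⟨m, rfl, hp⟩) (by exact_mod_cast hm)

section Tree

variable {T : SimpleGraph V}

theorem exists_adj_dist_eq (hT : T.Connected) {a c : V} {k : ℕ} (h : T.dist a c = k + 1) :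
    ∃ b, T.Adj a b ∧ T.dist b c = k := by
  obtain ⟨p, hp⟩ := hT.exists_walk_length_eq_dist a c
  cases p with
  | nil => simp at h
  | @cons _ b _ hab q =>
    refine ⟨b, hab, ?_⟩
    have h1 := dist_le q
    have h2 := hT.dist_triangle (u := a) (v := b) (w := c)
    have h3 := dist_eq_one_iff_adj.2 hab
    simp only [Walk.length_cons] at hp
    omega

theorem SimpleGraph.IsTree.eq_of_adj_of_dist_lt (hT : T.IsTree) {a b b' c : V} (hb : T.Adj a b)
    (hb' : T.Adj a b') (h : T.dist b c < T.dist a c) (h' : T.dist b' c < T.dist a c) :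
    b = b' := by
  have key : ∀ b, T.Adj a b → T.dist b c < T.dist a c →
      ∃ (hab : T.Adj a b) (q : T.Walk b c), (Walk.cons hab q).IsPath := by
    intro b hab hlt
    obtain ⟨q, hq⟩ := hT.connected.exists_walk_length_eq_dist b c
    refine ⟨hab, q, Walk.isPath_of_length_eq_dist _ ?_⟩
    have h1 := dist_le (Walk.cons hab q)
    simp only [Walk.length_cons] at h1 ⊢
    omega
  obtain ⟨h1, q, hq⟩ := key b hb h
  obtain ⟨h2, q', hq'⟩ := key b' hb' h'
  have := congrArg Subtype.val
    ((hT.isAcyclic.subsingleton_path a c).elim ⟨_, hq⟩ ⟨_, hq'⟩)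
  simp only [Walk.cons.injEq] at this
  exact this.1

theorem SimpleGraph.IsTree.dist_succ_or (hT : T.IsTree) {a b : V} (c : V) (h : T.Adj a b) :
    T.dist b c = T.dist a c + 1 ∨ T.dist a c = T.dist b c + 1 := by
  have h1 := hT.dist_eq_dist_add_one_of_adj c h
  rw [SimpleGraph.dist_comm (u := c), SimpleGraph.dist_comm (u := c)] at h1
  tauto

/-- A walk in a tree that does not backtrack keeps moving away from its starting point. -/
theorem SimpleGraph.IsTree.dist_succ_of_ne (hT : T.IsTree) {a b c z : V} (hab : T.Adj a b)
    (hbc : T.Adj b c) (hac : a ≠ c) (h : T.dist b z = T.dist a z + 1) :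
    T.dist c z = T.dist b z + 1 := by
  rcases hT.dist_succ_or z hbc with h1 | h1
  · exact h1
  · exact absurd (hT.eq_of_adj_of_dist_lt (c := z) hab.symm hbc (by omega) (by omega)) hac

variable {s : V → ℕ} {D : (Σ v : V, Fin (s v)) → (Σ v : V, Fin (s v)) → Prop}

theorem DPath.dist_le_and_mod_two (hT : T.IsTree) (hD : ∀ p q, D p q → T.Adj p.1 q.1) {n : ℕ}
    {p q : Σ v : V, Fin (s v)} (h : DPath D n p q) :
    T.dist p.1 q.1 ≤ n ∧ T.dist p.1 q.1 % 2 = n % 2 := by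
  induction n generalizing p with
  | zero => cases h; simp
  | succ k ih =>
    obtain ⟨r, hr, hp⟩ := h
    have h1 := ih hp
    have h2 := hT.dist_succ_or q.1 (hD _ _ hr)
    omega

theorem DPath.exists_step (hT : T.IsTree) (hD : ∀ p q, D p q → T.Adj p.1 q.1) {a b : V} {k : ℕ}
    {i : Fin (s a)} {q : Σ v : V, Fin (s v)} (h : DPath D (k + 1) ⟨a, i⟩ q) (hab : T.Adj a b)
    (hk : T.dist a q.1 = k + 1) (hb : T.dist b q.1 = k) :
    ∃ j, D ⟨a, i⟩ ⟨b, j⟩ ∧ DPath D k ⟨b, j⟩ q := by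
  obtain ⟨⟨w, j⟩, hr, hp⟩ := h
  have h1 : T.dist w q.1 ≤ k := (hp.dist_le_and_mod_two hT hD).1
  have haw : T.Adj a w := hD _ _ hr
  obtain rfl : w = b := hT.eq_of_adj_of_dist_lt (c := q.1) haw hab (by omega) (by omega)
  exact ⟨j, hr, hp⟩

variable (T s) in
/-- Any two copies of the ends of a path with four edges of `T` are joined in `D` by a directed
walk through copies of the inner vertices of that path. -/
def FourLinked (D : (Σ v : V, Fin (s v)) → (Σ v : V, Fin (s v)) → Prop) : Prop :=
  ∀ a b c d e, T.Adj a b → T.Adj b c → T.Adj c d → T.Adj d e → a ≠ c → b ≠ d → c ≠ e →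
    ∀ (i : Fin (s a)) (m : Fin (s e)), ∃ j k l,
      D ⟨a, i⟩ ⟨b, j⟩ ∧ D ⟨b, j⟩ ⟨c, k⟩ ∧ D ⟨c, k⟩ ⟨d, l⟩ ∧ D ⟨d, l⟩ ⟨e, m⟩

theorem FourLinked.swap (h : FourLinked T s D) : FourLinked T s (Function.swap D) := by
  intro a b c d e hab hbc hcd hde hac hbd hce i m
  obtain ⟨j, k, l, h1, h2, h3, h4⟩ := h e d c b a hde.symm hcd.symm hbc.symm hab.symm
    hce.symm hbd.symm hac.symm m i
  exact ⟨l, k, j, h4, h3, h2, h1⟩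

theorem fourLinked_of_exists_dPath (hT : T.IsTree) (hD : ∀ p q, D p q → T.Adj p.1 q.1)
    (h : ∀ p q, ∃ m ≤ 5, DPath D m p q) : FourLinked T s D := by
  intro a b c d e hab hbc hcd hde hac hbd hce i m
  have d1 : T.dist d e = 1 := dist_eq_one_iff_adj.2 hde
  have d2 : T.dist c e = 2 := by
    rw [hT.dist_succ_of_ne hde.symm hcd.symm hce.symm (by simp [d1]), d1]
  have d3 : T.dist b e = 3 := by
    rw [hT.dist_succ_of_ne hcd.symm hbc.symm hbd.symm (by omega), d2]
  have d4 : T.dist a e = 4 := by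
    rw [hT.dist_succ_of_ne hbc.symm hab.symm hac.symm (by omega), d3]
  obtain ⟨n, hn, hp⟩ := h ⟨a, i⟩ ⟨e, m⟩
  have := hp.dist_le_and_mod_two hT hD
  dsimp only at this
  obtain rfl : n = 4 := by omega
  obtain ⟨j, hj, hp⟩ := hp.exists_step hT hD hab d4 d3
  obtain ⟨k, hk, hp⟩ := hp.exists_step hT hD hbc d3 d2
  obtain ⟨l, hl, hp⟩ := hp.exists_step hT hD hcd d2 d1
  obtain ⟨m', hm, hp⟩ := hp.exists_step hT hD hde d1 (by simp)
  have hm' : (⟨e, m'⟩ : Σ v : V, Fin (s v)) = ⟨e, m⟩ := hp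
  obtain rfl : m' = m := by simpa using hm'
  exact ⟨j, k, l, hj, hk, hl, hm⟩

variable (T) in
/-- Apart from `b`, the vertex `a` has two neighbours that have a further neighbour. -/
def HasTwoBranches (a b : V) : Prop :=
  ∃ u u' x x', u ≠ u' ∧ T.Adj a u ∧ T.Adj a u' ∧ u ≠ b ∧ u' ≠ b ∧ T.Adj u x ∧ T.Adj u' x' ∧
    x ≠ a ∧ x' ≠ a

theorem Fin.eq_of_ne_of_ne {n : ℕ} (hn : n = 2) {i j k : Fin n} (hij : i ≠ j) (hkj : k ≠ j) :
    i = k := by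
  omega

variable {a b w y : V}

theorem FourLinked.exists_to_leaf (h : FourLinked T s D) (hD : ∀ p q, D p q → ¬ D q p)
    (ha : s a = 2) (hab : T.Adj a b) (hbr : HasTwoBranches T a b) (hbw : T.Adj b w)
    (hwy : T.Adj w y) (hwa : w ≠ a) (hyb : y ≠ b) (hs : ∀ v, 2 ≤ s v) (l : Fin (s a))
    (j : Fin (s y)) :
    ∃ m n, D ⟨a, l⟩ ⟨b, m⟩ ∧ D ⟨b, m⟩ ⟨w, n⟩ ∧ D ⟨w, n⟩ ⟨y, j⟩ := by
  obtain ⟨u, u', x, x', huu', hau, hau', hub, hub', hux, hux', hxa, hxa'⟩ := hbr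
  have key : ∃ v k, T.Adj a v ∧ v ≠ b ∧ D ⟨v, k⟩ ⟨a, l⟩ := by
    obtain ⟨k, l₁, k', -, h2, h3, -⟩ := h x u a u' x' hux.symm hau.symm hau' hux' hxa huu' hxa'.symm
      ⟨0, by have := hs x; omega⟩ ⟨0, by have := hs x'; omega⟩
    by_cases hl : l = l₁
    · subst hl
      exact ⟨u, k, hau, hub, h2⟩
    · obtain ⟨l₂, m, n, h4, -⟩ := h u' a b w y hau'.symm hab hbw hwy hub' hwa.symm hyb.symm k' j
      have h5 : l₂ ≠ l₁ := by
        rintro rfl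
        exact hD _ _ h3 h4
      obtain rfl := Fin.eq_of_ne_of_ne ha hl h5
      exact ⟨u', k', hau', hub', h4⟩
  obtain ⟨v, k, hav, hvb, hvl⟩ := key
  obtain ⟨l₁, m, n, h1, h2, h3, h4⟩ := h v a b w y hav.symm hab hbw hwy hvb hwa.symm hyb.symm k j
  obtain ⟨-, -, l₂, -, -, -, h5⟩ := h y w b a v hwy.symm hbw.symm hab.symm hav hyb hwa hvb.symm j k
  have h6 : l₁ ≠ l₂ := by
    rintro rfl
    exact hD _ _ h1 h5
  have h7 : l ≠ l₂ := by
    rintro rfl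
    exact hD _ _ hvl h5
  obtain rfl := Fin.eq_of_ne_of_ne ha h7 h6
  exact ⟨m, n, h2, h3, h4⟩

theorem FourLinked.exists_pair_into_leaf (h : FourLinked T s D) (hD : ∀ p q, D p q → ¬ D q p)
    (ha : s a = 2) (hb : s b = 2) (hab : T.Adj a b) (hbr : HasTwoBranches T a b)
    (hbr' : HasTwoBranches T b a) (hbw : T.Adj b w) (hwy : T.Adj w y) (hwa : w ≠ a) (hyb : y ≠ b)
    (hs : ∀ v, 2 ≤ s v) (j : Fin (s y)) :
    ∃ n n', n ≠ n' ∧ D ⟨w, n⟩ ⟨y, j⟩ ∧ D ⟨w, n'⟩ ⟨y, j⟩ := by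
  have hD' : ∀ p q, Function.swap D p q → ¬ Function.swap D q p := fun p q => hD q p
  have hbr₀ := hbr
  obtain ⟨u, -, x, -, -, hau, -, hub, -, hux, -, hxa, -⟩ := hbr₀
  have key : ∀ m, ∃ n, D ⟨b, m⟩ ⟨w, n⟩ ∧ D ⟨w, n⟩ ⟨y, j⟩ := by
    intro m
    have x₀ : Fin (s x) := ⟨0, by have := hs x; omega⟩
    obtain ⟨l, -, hml, -⟩ := h.swap.exists_to_leaf hD' hb hab.symm hbr' hau hux hub hxa hs m x₀
    obtain ⟨m₁, n, h1, h2, h3⟩ := h.exists_to_leaf hD ha hab hbr hbw hwy hwa hyb hs l j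
    obtain ⟨m₂, -, h4, -⟩ := h.swap.exists_to_leaf hD' ha hab hbr hbw hwy hwa hyb hs l j
    have h5 : m₁ ≠ m₂ := by
      rintro rfl
      exact hD _ _ h1 h4
    have h6 : m ≠ m₂ := by
      rintro rfl
      exact hD _ _ hml h4
    obtain rfl := Fin.eq_of_ne_of_ne hb h6 h5
    exact ⟨n, h2, h3⟩
  obtain ⟨n, h1, h2⟩ := key ⟨0, by omega⟩
  obtain ⟨n', h3, h4⟩ := key ⟨1, by omega⟩
  refine ⟨n, n', ?_, h2, h4⟩
  rintro rfl
  obtain ⟨m, -, -, h5, -⟩ := h w b a u x hbw.symm hab.symm hau hux hwa hub.symm hxa.symm n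
    ⟨0, by have := hs x; omega⟩
  have h6 : m ≠ ⟨0, by omega⟩ := by
    rintro rfl
    exact hD _ _ h1 h5
  have h7 : m ≠ ⟨1, by omega⟩ := by
    rintro rfl
    exact hD _ _ h3 h5
  simp only [ne_eq, Fin.ext_iff] at h6 h7
  omega

theorem FourLinked.four_le (h : FourLinked T s D) (hD : ∀ p q, D p q → ¬ D q p)
    (ha : s a = 2) (hb : s b = 2) (hab : T.Adj a b) (hbr : HasTwoBranches T a b)
    (hbr' : HasTwoBranches T b a) (hbw : T.Adj b w) (hwy : T.Adj w y) (hwa : w ≠ a) (hyb : y ≠ b)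
    (hs : ∀ v, 2 ≤ s v) : 4 ≤ s w := by
  have y₀ : Fin (s y) := ⟨0, by have := hs y; omega⟩
  obtain ⟨i, i', hi, h1, h2⟩ :=
    h.exists_pair_into_leaf hD ha hb hab hbr hbr' hbw hwy hwa hyb hs y₀
  obtain ⟨k, k', hk, h3, h4⟩ :=
    h.swap.exists_pair_into_leaf (fun p q => hD q p) ha hb hab hbr hbr' hbw hwy hwa hyb hs y₀
  have hne : ∀ {p q}, D ⟨w, p⟩ ⟨y, y₀⟩ → Function.swap D ⟨w, q⟩ ⟨y, y₀⟩ → p ≠ q := by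
    rintro p _ hp hq rfl
    exact hD _ _ hp hq
  have h5 := hne h1 h3
  have h6 := hne h1 h4
  have h7 := hne h2 h3
  have h8 := hne h2 h4
  omega

theorem IsOrientation.asymm {G : SimpleGraph V} {D : V → V → Prop} (h : IsOrientation G D)
    (u v : V) (huv : D u v) : ¬ D v u :=
  (h.2 u v (h.1 u v huv)).1 huv

end Tree

section UpperBound

variable (T : SimpleGraph V) (s : V → ℕ) (a : V)

open Classical in
/-- Whether the edge between `p`, at even distance from `a`, and `q`, at odd distance from `a`,
is directed from `p` to `q` in `radialOrientation`. -/
def EvenToOdd (p q : Σ v : V, Fin (s v)) : Prop :=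
  if p.1 = a then (p.2.val = 0 ↔ q.2.val = 0)
  else if T.dist a q.1 = 1 then q.2.val ≠ 0 else p.2.val = 0

open Classical in
/-- An orientation of the vertex-multiplication of a tree which has diameter at most `6` when
the tree has an edge `ab` whose ends have eccentricity at most `3`. -/
def radialOrientation (p q : Σ v : V, Fin (s v)) : Prop :=
  T.Adj p.1 q.1 ∧ if T.dist a p.1 % 2 = 0 then EvenToOdd T s a p q else ¬ EvenToOdd T s a q p

variable {T s a}

theorem isOrientation_radialOrientation (hT : T.IsTree) :
    IsOrientation (vertexMult T s) (radialOrientation T s a) := by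
  refine ⟨fun u v h => h.1, fun u v h => ?_⟩
  have h1 : T.Adj u.1 v.1 := h
  have h2 := hT.dist_eq_dist_add_one_of_adj a h1
  unfold radialOrientation
  by_cases h3 : T.dist a u.1 % 2 = 0
  · have h4 : ¬ T.dist a v.1 % 2 = 0 := by omega
    simp [h1, h1.symm, h3, h4]
  · have h4 : T.dist a v.1 % 2 = 0 := by omega
    simp [h1, h1.symm, h3, h4]

variable {b : V}

theorem radialOrientation_hub {i : Fin (s a)} {q : Σ v : V, Fin (s v)} (h : T.Adj a q.1) :
    (radialOrientation T s a ⟨a, i⟩ q ↔ (i.val = 0 ↔ q.2.val = 0)) ∧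
      (radialOrientation T s a q ⟨a, i⟩ ↔ ¬ (i.val = 0 ↔ q.2.val = 0)) := by
  have h1 : T.dist a q.1 = 1 := dist_eq_one_iff_adj.2 h
  simp [radialOrientation, EvenToOdd, h, h.symm, h1]

theorem radialOrientation_near {p q : Σ v : V, Fin (s v)} (h : T.Adj p.1 q.1)
    (hp : T.dist a p.1 = 2) (hq : T.dist a q.1 = 1) :
    (radialOrientation T s a p q ↔ q.2.val ≠ 0) ∧
      (radialOrientation T s a q p ↔ q.2.val = 0) := by
  have h1 : p.1 ≠ a := by
    rintro h
    simp [h] at hp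
  simp [radialOrientation, EvenToOdd, h, h.symm, h1, hp, hq]

theorem radialOrientation_far {p q : Σ v : V, Fin (s v)} (h : T.Adj p.1 q.1)
    (hp : T.dist a p.1 = 2) (hq : T.dist a q.1 = 3) :
    (radialOrientation T s a p q ↔ p.2.val = 0) ∧
      (radialOrientation T s a q p ↔ p.2.val ≠ 0) := by
  have h1 : p.1 ≠ a := by
    rintro h
    simp [h] at hp
  simp [radialOrientation, EvenToOdd, h, h.symm, h1, hp, hq]

/-- The copies of the two central vertices, in the order of a directed `4`-cycle. -/
def hub (ha : s a = 2) (hb : s b = 2) : Fin 4 → Σ v : V, Fin (s v) :=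
  ![⟨a, ⟨0, by omega⟩⟩, ⟨b, ⟨0, by omega⟩⟩, ⟨a, ⟨1, by omega⟩⟩, ⟨b, ⟨1, by omega⟩⟩]

theorem radialOrientation_hub_succ (ha : s a = 2) (hb : s b = 2) (hab : T.Adj a b) (i : Fin 4) :
    radialOrientation T s a (hub ha hb i) (hub ha hb (i + 1)) := by
  fin_cases i
  · exact (radialOrientation_hub (q := hub ha hb 1) hab).1.2 (by simp [hub])
  · exact (radialOrientation_hub (q := hub ha hb 1) hab).2.2 (by simp [hub])
  · exact (radialOrientation_hub (q := hub ha hb 3) hab).1.2 (by simp [hub])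
  · exact (radialOrientation_hub (q := hub ha hb 3) hab).2.2 (by simp [hub])

theorem dPath_hub (ha : s a = 2) (hb : s b = 2) (hab : T.Adj a b) (i j : Fin 4) :
    DPath (radialOrientation T s a) (j - i).val (hub ha hb i) (hub ha hb j) := by
  have key : ∀ (n : ℕ) (i : Fin 4),
      DPath (radialOrientation T s a) n (hub ha hb i) (hub ha hb (i + Fin.ofNat 4 n)) := by
    intro n
    induction n with
    | zero => intro i; simp [DPath]
    | succ k ih =>
      intro i
      refine ⟨_, radialOrientation_hub_succ ha hb hab i, ?_⟩
      have : i + Fin.ofNat 4 (k + 1) = i + 1 + Fin.ofNat 4 k := by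
        apply Fin.ext
        simp only [Fin.val_add, Fin.val_ofNat, Fin.val_one]
        omega
      rw [this]
      exact ih _
  have h := key (j - i).val i
  rw [Fin.ofNat_eq_cast, Fin.cast_val_eq_self, add_sub_cancel] at h
  exact h

theorem exists_dPath_hub (hT : T.IsTree) (ha : s a = 2) (hb : s b = 2)
    (hs : ∀ v, 2 ≤ s v) (hab : T.Adj a b) (hda : ∀ v, T.dist v a ≤ 3) (hdb : ∀ v, T.dist v b ≤ 3)
    (p : Σ v : V, Fin (s v)) :
    (∃ n i, DPath (radialOrientation T s a) n p (hub ha hb i) ∧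
      (n ≤ 1 ∨ n = 2 ∧ (i = 0 ∨ i = 3))) ∧
    ∃ n i, DPath (radialOrientation T s a) n (hub ha hb i) p ∧
      (n ≤ 1 ∨ n = 2 ∧ (i = 0 ∨ i = 1)) := by
  obtain ⟨v, k⟩ := p
  have hadj : ∀ {v c : V}, T.dist v c = 1 → T.Adj c v := fun h => (dist_eq_one_iff_adj.1 h).symm
  have hdab : ∀ v, T.dist v b = T.dist v a + 1 ∨ T.dist v a = T.dist v b + 1 := by
    intro v
    have := hT.dist_succ_or v hab
    rwa [SimpleGraph.dist_comm (v := v), SimpleGraph.dist_comm (v := v)] at this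
  have hswap : ∀ {v : V} {d : ℕ}, T.dist v a = d → T.dist a v = d :=
    fun h => by rwa [SimpleGraph.dist_comm]
  have hhub : ∀ (i : Fin 4),
      (∃ n j, DPath (radialOrientation T s a) n (hub ha hb i) (hub ha hb j) ∧
        (n ≤ 1 ∨ n = 2 ∧ (j = 0 ∨ j = 3))) ∧
      ∃ n j, DPath (radialOrientation T s a) n (hub ha hb j) (hub ha hb i) ∧
        (n ≤ 1 ∨ n = 2 ∧ (j = 0 ∨ j = 1)) :=
    fun i => ⟨⟨0, i, rfl, by omega⟩, ⟨0, i, rfl, by omega⟩⟩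
  have h1 := hdab v
  have h2 := hda v
  have h3 := hdb v
  have hcases : T.dist v a = 0 ∨ T.dist v b = 0 ∨ (T.dist v a = 1 ∧ T.dist v b = 2) ∨
    (T.dist v a = 2 ∧ T.dist v b = 1) ∨ (T.dist v a = 2 ∧ T.dist v b = 3) ∨
    (T.dist v a = 3 ∧ T.dist v b = 2) := by omega
  rcases hcases with h | h | ⟨h, h'⟩ | ⟨h, h'⟩ | ⟨h, h'⟩ | ⟨h, h'⟩
  · obtain rfl := hT.connected.dist_eq_zero_iff.1 h
    obtain hk | hk : k = ⟨0, by omega⟩ ∨ k = ⟨1, by omega⟩ := by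
      simp only [Fin.ext_iff]; omega
    · exact hk ▸ hhub 0
    · exact hk ▸ hhub 2
  · obtain rfl := hT.connected.dist_eq_zero_iff.1 h
    obtain hk | hk : k = ⟨0, by omega⟩ ∨ k = ⟨1, by omega⟩ := by
      simp only [Fin.ext_iff]; omega
    · exact hk ▸ hhub 1
    · exact hk ▸ hhub 3
  · have hr := fun i => radialOrientation_hub (i := i) (q := ⟨v, k⟩) (hadj h)
    by_cases hk : k.val = 0
    · exact ⟨⟨1, 2, .single ((hr _).2.2 (by simp [hk])), by omega⟩,
        ⟨1, 0, .single ((hr _).1.2 (by simp [hk])), by omega⟩⟩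
    · exact ⟨⟨1, 0, .single ((hr _).2.2 (by simp [hk])), by omega⟩,
        ⟨1, 2, .single ((hr _).1.2 (by simp [hk])), by omega⟩⟩
  · have hr := fun i => radialOrientation_near (p := ⟨v, k⟩) (q := ⟨b, i⟩) (hadj h').symm
      (hswap h) (dist_eq_one_iff_adj.2 hab)
    exact ⟨⟨1, 3, .single ((hr _).1.2 (by simp)), by omega⟩,
      ⟨1, 1, .single ((hr _).2.2 (by simp)), by omega⟩⟩
  · obtain ⟨u, hvu, hu⟩ := exists_adj_dist_eq hT.connected h
    have hr := fun (i : Fin (s a)) (j : Fin (s u)) =>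
      radialOrientation_hub (i := i) (q := ⟨u, j⟩) (hadj hu)
    have hr' := fun j => radialOrientation_near (p := ⟨v, k⟩) (q := ⟨u, j⟩) hvu (hswap h) (hswap hu)
    have := hs u
    exact ⟨⟨2, 0, .two ((hr' ⟨1, by omega⟩).1.2 (by simp)) ((hr _ _).2.2 (by simp)), by omega⟩,
      ⟨2, 0, .two ((hr _ _).1.2 (by simp)) ((hr' ⟨0, by omega⟩).2.2 (by simp)), by omega⟩⟩
  · obtain ⟨w, hvw, hw⟩ := exists_adj_dist_eq hT.connected h'
    have hw' : T.dist w a = 2 := by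
      have h4 := hT.dist_succ_or a hvw
      have h5 := hdab w
      omega
    have hr := fun (i : Fin (s b)) (j : Fin (s w)) =>
      radialOrientation_near (p := ⟨w, j⟩) (q := ⟨b, i⟩) (hadj hw).symm
        (hswap hw') (dist_eq_one_iff_adj.2 hab)
    have hr' := fun j => radialOrientation_far (p := ⟨w, j⟩) (q := ⟨v, k⟩) hvw.symm
      (hswap hw') (hswap h)
    have := hs w
    exact ⟨⟨2, 3, .two ((hr' ⟨1, by omega⟩).2.2 (by simp)) ((hr _ _).1.2 (by simp)), by omega⟩,
      ⟨2, 1, .two ((hr _ _).2.2 (by simp)) ((hr' ⟨0, by omega⟩).1.2 (by simp)), by omega⟩⟩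

theorem exists_dPath_radialOrientation (hT : T.IsTree) (ha : s a = 2) (hb : s b = 2)
    (hs : ∀ v, 2 ≤ s v) (hab : T.Adj a b) (hda : ∀ v, T.dist v a ≤ 3) (hdb : ∀ v, T.dist v b ≤ 3)
    (p q : Σ v : V, Fin (s v)) :
    ∃ m ≤ 6, DPath (radialOrientation T s a) m p q := by
  obtain ⟨⟨n, i, hp, hn⟩, -⟩ := exists_dPath_hub hT ha hb hs hab hda hdb p
  obtain ⟨-, n', j, hq, hn'⟩ := exists_dPath_hub hT ha hb hs hab hda hdb q
  refine ⟨_, ?_, (hp.append (dPath_hub ha hb hab i j)).append hq⟩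
  omega

end UpperBound

theorem dist_le_of_ecc_eq {T : SimpleGraph V} {v : V} {n : ℕ} (h : ecc T v = n) (u : V) :
    T.dist u v ≤ n := by
  have h1 : T.edist v u ≤ n := h ▸ le_iSup (fun u => T.edist v u) u
  rw [SimpleGraph.dist_comm]
  exact ENat.toNat_le_of_le_natCast h1

theorem exists_adj_ne_of_ncard_neighborSet_ne_one [Finite V] {T : SimpleGraph V} {u v : V}
    (huv : T.Adj u v) (h : (T.neighborSet u).ncard ≠ 1) : ∃ x, T.Adj u x ∧ x ≠ v := by
  have h1 : 0 < (T.neighborSet u).ncard := (Set.ncard_pos).2 ⟨v, huv⟩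
  obtain ⟨x, hx, hne⟩ := Set.exists_ne_of_one_lt_ncard (s := T.neighborSet u) (by omega) v
  exact ⟨x, hx, hne⟩

theorem hasTwoBranches_of_ncard [Finite V] {T : SimpleGraph V} {a b : V}
    (h : 2 ≤ {u : V | T.Adj a u ∧ u ≠ b ∧ (T.neighborSet u).ncard ≠ 1}.ncard) :
    HasTwoBranches T a b := by
  obtain ⟨u, u', ⟨h1, h2, h3⟩, ⟨h1', h2', h3'⟩, hne⟩ := (Set.one_lt_ncard_iff).1 h
  obtain ⟨x, hx, hxa⟩ := exists_adj_ne_of_ncard_neighborSet_ne_one h1.symm h3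
  obtain ⟨x', hx', hxa'⟩ := exists_adj_ne_of_ncard_neighborSet_ne_one h1'.symm h3'
  exact ⟨u, u', x, x', hne, h1, h1', h2, h2', hx, hx', hxa, hxa'⟩

theorem FourLinked.four_le_sInf [Finite V] {T : SimpleGraph V} {s : V → ℕ}
    {D : (Σ v : V, Fin (s v)) → (Σ v : V, Fin (s v)) → Prop} {a b : V}
    (h : FourLinked T s D) (hD : ∀ p q, D p q → ¬ D q p) (ha : s a = 2) (hb : s b = 2)
    (hab : T.Adj a b) (hs : ∀ v, 2 ≤ s v)
    (hca : 2 ≤ {u : V | T.Adj a u ∧ u ≠ b ∧ (T.neighborSet u).ncard ≠ 1}.ncard)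
    (hcb : 2 ≤ {u : V | T.Adj b u ∧ u ≠ a ∧ (T.neighborSet u).ncard ≠ 1}.ncard) :
    4 ≤ sInf (s '' {u : V | T.Adj b u ∧ u ≠ a ∧ (T.neighborSet u).ncard ≠ 1}) := by
  have hne := Set.nonempty_of_ncard_ne_zero (Nat.ne_of_gt (lt_of_lt_of_le two_pos hcb))
  obtain ⟨w, ⟨hbw, hwa, hw⟩, hmin⟩ := Nat.sInf_mem (hne.image s)
  obtain ⟨y, hwy, hyb⟩ := exists_adj_ne_of_ncard_neighborSet_ne_one hbw.symm hw
  rw [← hmin]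
  exact h.four_le hD ha hb hab (hasTwoBranches_of_ncard hca) (hasTwoBranches_of_ncard hcb) hbw hwy
    hwa hyb hs

theorem stmt10 [Fintype V] (T : SimpleGraph V) (hT : T.IsTree) (hdiam : T.ediam = 5)
    (v₁ v₂ : V) (hadj : T.Adj v₁ v₂) (hecc₁ : ecc T v₁ = 3) (hecc₂ : ecc T v₂ = 3)
    (s : V → ℕ) (hs : ∀ v, 2 ≤ s v) (hs₁ : s v₁ = 2) (hs₂ : s v₂ = 2)
    (NL₁ NL₂ : Set V)
    (hNL₁ : NL₁ = {u : V | T.Adj v₁ u ∧ u ≠ v₂ ∧ (T.neighborSet u).ncard ≠ 1})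
    (hNL₂ : NL₂ = {u : V | T.Adj v₂ u ∧ u ≠ v₁ ∧ (T.neighborSet u).ncard ≠ 1})
    (m₁ m₂ : ℕ) (hm₁ : m₁ = sInf (s '' NL₁)) (hm₂ : m₂ = sInf (s '' NL₂))
    (hm : (2 ≤ m₁ ∧ m₁ ≤ 3) ∨ (2 ≤ m₂ ∧ m₂ ≤ 3))
    (hcard : 2 ≤ NL₁.ncard ∧ 2 ≤ NL₂.ncard) :
    (∀ D : (Σ v : V, Fin (s v)) → (Σ v : V, Fin (s v)) → Prop,
      IsOrientation (vertexMult T s) D → odiam D ≠ 5) ∧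
    orientNum (vertexMult T s) = 6 := by
  subst hNL₁ hNL₂
  have hlower : ∀ D : (Σ v : V, Fin (s v)) → (Σ v : V, Fin (s v)) → Prop,
      IsOrientation (vertexMult T s) D → ¬ odiam D ≤ (5 : ℕ) := by
    intro D hD hle
    have hF := fourLinked_of_exists_dPath hT hD.1 (exists_dPath_of_odiam_le hle)
    have h1 := hF.four_le_sInf hD.asymm hs₁ hs₂ hadj hs hcard.1 hcard.2
    have h2 := hF.four_le_sInf hD.asymm hs₂ hs₁ hadj.symm hs hcard.2 hcard.1
    omega
  refine ⟨fun D hD h => hlower D hD h.le, le_antisymm ?_ ?_⟩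
  · have hpath := exists_dPath_radialOrientation hT hs₁ hs₂ hs hadj
      (dist_le_of_ecc_eq (n := 3) hecc₁) (dist_le_of_ecc_eq (n := 3) hecc₂)
    refine le_trans (sInf_le ⟨_, ⟨isOrientation_radialOrientation hT, fun u v => ?_⟩, rfl⟩)
      (odiam_le_of_exists_dPath (n := 6) hpath)
    obtain ⟨m, -, hp⟩ := hpath u v
    exact ⟨m, hp⟩
  · refine le_sInf ?_
    rintro _ ⟨D, hD, rfl⟩
    exact Order.add_one_le_of_lt (not_le.1 (hlower D hD.1))
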